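/- arXiv:math/0312053 — 3 statements merged into one kernel-verified Lean document; each statement's English description precedes it below -/
import Mathlib

section
/- Let s and t be natural numbers with s ≥ 2 and t ≥ 2. If there exists a function μ from a finite index set of cardinality s·t³·(s²-s+1) to the nonnegative reals such that the sum of μ over the index set equals s·t³·(s-1)²·(t²+t+1) and the sum of μ² over the index set equals s·t³·(t²+t+1)·(s-1)·((t²+t+1)(s-1)-(t²+t)), then s²-s-t²-t ≥ 0. -/
open Finset

/-- Arithmetic core of Theorem 1: the existence of a nonnegative weight function with the
given sum and sum of squares on an index set of cardinality `s·t³·(s²-s+1)` forces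
`s²-s-t²-t ≥ 0`. -/
theorem stmt_2 (s t : ℕ) (hs : 2 ≤ s) (ht : 2 ≤ t)
    (ι : Type*) [Fintype ι]
    (hcard : Fintype.card ι = s * t^3 * (s^2 - s + 1))
    (μ : ι → ℝ) (hμ : ∀ i, 0 ≤ μ i)
    (hsum : ∑ i, μ i = (s:ℝ) * (t:ℝ)^3 * ((s:ℝ) - 1)^2 * ((t:ℝ)^2 + (t:ℝ) + 1))
    (hsq : ∑ i, (μ i)^2 =
      (s:ℝ) * (t:ℝ)^3 * ((t:ℝ)^2 + (t:ℝ) + 1) * ((s:ℝ) - 1) *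
        (((t:ℝ)^2 + (t:ℝ) + 1) * ((s:ℝ) - 1) - ((t:ℝ)^2 + (t:ℝ)))) :
    (s:ℤ)^2 - (s:ℤ) - (t:ℤ)^2 - (t:ℤ) ≥ 0 := by
  have hc := sq_sum_le_card_mul_sum_sq (s := (Finset.univ : Finset ι)) (f := μ)
  have hle : s ≤ s ^ 2 := by nlinarith
  have hcard' : ((Finset.univ : Finset ι).card : ℝ)
      = (s:ℝ) * (t:ℝ)^3 * ((s:ℝ)^2 - s + 1) := by
    rw [Finset.card_univ, hcard]
    push_cast [Nat.cast_sub hle]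
    ring
  rw [hsum, hsq, hcard'] at hc
  have hs' : (2:ℝ) ≤ s := by exact_mod_cast hs
  have ht' : (2:ℝ) ≤ t := by exact_mod_cast ht
  have hs1 : (0:ℝ) < (s:ℝ) - 1 := by linarith
  have hs0 : (0:ℝ) < (s:ℝ) := by linarith
  have ht0 : (0:ℝ) < (t:ℝ) := by linarith
  have hpos : 0 < ((s:ℝ) * (t:ℝ)^3)^2 * ((t:ℝ)^2 + t + 1) * ((s:ℝ) - 1) := by positivity
  have key : 0 ≤ (((s:ℝ) * (t:ℝ)^3)^2 * ((t:ℝ)^2 + t + 1) * ((s:ℝ) - 1)) *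
      ((s:ℝ)^2 - s - (t:ℝ)^2 - t) := by
    linear_combination hc
  have h := nonneg_of_mul_nonneg_right key hpos
  have h2 : (0:ℝ) ≤ (((s:ℤ)^2 - (s:ℤ) - (t:ℤ)^2 - (t:ℤ) : ℤ) : ℝ) := by
    push_cast
    exact h
  exact_mod_cast h2
end

section
/- Let q be a natural number with q ≥ 2. There is no function μ from a finite index set of cardinality q⁴·(q²-q+1) to the reals such that the sum of μ over the index set equals q⁴·(q-1)²·(q²+q+1) and the sum of μ² over the index set equals q⁴·(q²+q+1)·(q-1)·(q³-q²-q-1). -/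
open Finset

/-- For `q ≥ 2` there is no real weight function on an index set of cardinality
`q⁴(q²-q+1)` with sum `q⁴(q-1)²(q²+q+1)` and sum of squares
`q⁴(q²+q+1)(q-1)(q³-q²-q-1)`. -/
theorem stmt_3 (q : ℕ) (hq : 2 ≤ q) :
    ¬ ∃ (ι : Type) (S : Finset ι) (μ : ι → ℝ),
      S.card = q^4 * (q^2 - q + 1) ∧
      ∑ i ∈ S, μ i = (q:ℝ)^4 * ((q:ℝ) - 1)^2 * ((q:ℝ)^2 + (q:ℝ) + 1) ∧
      ∑ i ∈ S, (μ i)^2 =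
        (q:ℝ)^4 * ((q:ℝ)^2 + (q:ℝ) + 1) * ((q:ℝ) - 1) *
          ((q:ℝ)^3 - (q:ℝ)^2 - (q:ℝ) - 1) := by
  rintro ⟨ι, S, μ, hc, h1, h2⟩
  have h := sq_sum_le_card_mul_sum_sq (s := S) (f := μ)
  have hle : q ≤ q ^ 2 := by nlinarith
  have hc' : (S.card : ℝ) = (q:ℝ)^4 * ((q:ℝ)^2 - q + 1) := by
    rw [hc]; push_cast [Nat.cast_sub hle]; ring
  rw [h1, h2, hc'] at h
  have hq' : (2:ℝ) ≤ q := by exact_mod_cast hq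
  have hpos : 0 < (q:ℝ)^8 * ((q:ℝ)^2 + q + 1) * ((q:ℝ) - 1) * (2 * q) := by
    have : (0:ℝ) < (q:ℝ) - 1 := by linarith
    have : (0:ℝ) < q := by linarith
    positivity
  nlinarith [h, hpos]
end

section
/- For all real numbers s ≥ 2 and t ≥ 2 satisfying s·t³·(s²-s+1) · s·t³·(t²+t+1)·(s-1)·((t²+t+1)·(s-1)-(t²+t)) ≥ (s·t³·(s-1)²·(t²+t+1))², the inequality s²-s-t²-t ≥ 0 holds. -/
/-- The concluding implication in the proof of Theorem 1: Cauchy's inequality for the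
computed counts forces `s²-s-t²-t ≥ 0`. -/
theorem stmt_11 (s t : ℝ) (hs : 2 ≤ s) (ht : 2 ≤ t)
    (hC : s * t^3 * (s^2 - s + 1) *
        (s * t^3 * (t^2 + t + 1) * (s - 1) * ((t^2 + t + 1) * (s - 1) - (t^2 + t)))
      ≥ (s * t^3 * (s - 1)^2 * (t^2 + t + 1))^2) :
    s^2 - s - t^2 - t ≥ 0 := by
  have h1 : 0 < s - 1 := by linarith
  have h2 : 0 < (s * t^3)^2 * (t^2 + t + 1) * (s - 1) := by positivity
  refine nonneg_of_mul_nonneg_right (?_ : 0 ≤ ((s * t^3)^2 * (t^2 + t + 1) * (s - 1)) * _) h2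
  linarith [hC]
end
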